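/- arXiv:1504.05566 — 3 statements merged into one kernel-verified Lean document; each statement's English description precedes it below -/
import Mathlib

section
/- Suppose every subset of sensors of size θ determines the state, but some subset of size θ − 1 does not determine the state. Then there exist distinct states x1 ≠ x2 such that the symbol Hamming distance between F x1 and F x2 is exactly p − θ + 1; consequently, the minimum symbol Hamming distance between observation vectors of distinct states is exactly p − θ + 1. -/
/-- The number of agreeing coordinates and the Hamming distance add up to the length. -/
theorem card_filter_eq_add_hammingDist {ι Y : Type*} [Fintype ι] [DecidableEq Y] (u v : ι → Y) :
    (Finset.univ.filter fun d => u d = v d).card + hammingDist u v = Fintype.card ι :=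
  Finset.card_filter_add_card_filter_not (s := Finset.univ) (fun d => u d = v d)

/-- If every subset of sensors of size `θ` determines the state but some subset of
size `θ - 1` does not, then there are distinct states whose observation vectors have
symbol Hamming distance exactly `p - θ + 1`; consequently, the minimum symbol
Hamming distance between observation vectors of distinct states is exactly
`p - θ + 1`. -/
theorem min_hammingDist_eq_of_sparse_observable {p θ : ℕ} (hθ : 0 < θ) (hθp : θ ≤ p)
    {X Y : Type*} [DecidableEq Y] (F : X → Fin p → Y)
    (hdet : ∀ s : Finset (Fin p), s.card = θ →
      ∀ x1 x2 : X, (∀ d ∈ s, F x1 d = F x2 d) → x1 = x2)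
    (hfail : ∃ s : Finset (Fin p), s.card = θ - 1 ∧
      ∃ x1 x2 : X, x1 ≠ x2 ∧ (∀ d ∈ s, F x1 d = F x2 d)) :
    (∃ x1 x2 : X, x1 ≠ x2 ∧ hammingDist (F x1) (F x2) = p - θ + 1) ∧
      (∀ x1 x2 : X, x1 ≠ x2 → p - θ + 1 ≤ hammingDist (F x1) (F x2)) := by
  have lower : ∀ x1 x2 : X, x1 ≠ x2 → p - θ + 1 ≤ hammingDist (F x1) (F x2) := by
    intro x1 x2 hne
    have hsum := card_filter_eq_add_hammingDist (F x1) (F x2)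
    rw [Fintype.card_fin] at hsum
    by_contra! hlt
    obtain ⟨s, hs, hcard⟩ := Finset.exists_subset_card_eq
      (show θ ≤ (Finset.univ.filter fun d => F x1 d = F x2 d).card by omega)
    exact hne (hdet s hcard x1 x2 fun d hd => (Finset.mem_filter.mp (hs hd)).2)
  refine ⟨?_, lower⟩
  obtain ⟨s, hcard, x1, x2, hne, hs⟩ := hfail
  refine ⟨x1, x2, hne, ?_⟩
  have hsum := card_filter_eq_add_hammingDist (F x1) (F x2)
  rw [Fintype.card_fin] at hsum
  have hle : s.card ≤ (Finset.univ.filter fun d => F x1 d = F x2 d).card :=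
    Finset.card_le_card fun d hd => Finset.mem_filter.mpr ⟨Finset.mem_univ d, hs d hd⟩
  have := lower x1 x2 hne
  omega
end

section
/- Suppose every subset of sensors of size θ determines the state and θ ≤ p − 2k. Then exact state recovery is possible despite corruption of any k sensors: for any states x1, x2, any subsets κ1, κ2 ⊆ Fin p with |κ1| ≤ k and |κ2| ≤ k, and any observation vector y : Fin p → Y satisfying y d = F x1 d for all d ∉ κ1 and y d = F x2 d for all d ∉ κ2, one has x1 = x2. -/
/-- If every subset of sensors of size `θ` determines the state and `θ ≤ p - 2k`,
then exact state recovery is possible despite corruption of any `k` sensors. -/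
theorem exact_recovery_of_sparse_observable {p θ k : ℕ} (hθ : 0 < θ) (hk : 0 < k)
    (hθp : θ ≤ p) (hcond : θ ≤ p - 2 * k)
    {X Y : Type*} (F : X → Fin p → Y)
    (hdet : ∀ s : Finset (Fin p), s.card = θ →
      ∀ x1 x2 : X, (∀ d ∈ s, F x1 d = F x2 d) → x1 = x2) :
    ∀ (x1 x2 : X) (κ1 κ2 : Finset (Fin p)), κ1.card ≤ k → κ2.card ≤ k →
      ∀ y : Fin p → Y, (∀ d, d ∉ κ1 → y d = F x1 d) → (∀ d, d ∉ κ2 → y d = F x2 d) →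
        x1 = x2 := by
  intro x1 x2 κ1 κ2 h1 h2 y hy1 hy2
  have hcard : θ ≤ (κ1 ∪ κ2)ᶜ.card := by
    rw [Finset.card_compl, Fintype.card_fin]
    have := Finset.card_union_le κ1 κ2
    omega
  obtain ⟨s, hs, hsθ⟩ := Finset.exists_subset_card_eq hcard
  refine hdet s hsθ x1 x2 fun d hd => ?_
  have hd' := hs hd
  rw [Finset.mem_compl, Finset.mem_union, not_or] at hd'
  exact (hy1 d hd'.1).symm.trans (hy2 d hd'.2)
end

section
/- Suppose 2k ≥ p − θ + 1 and there exist distinct states x1 ≠ x2 whose observation vectors F x1 and F x2 agree on exactly θ − 1 sensors (i.e., their symbol Hamming distance is p − θ + 1). Then exact state recovery against a k-adversary is impossible: there exist an observation vector y : Fin p → Y and subsets κ1, κ2 ⊆ Fin p with |κ1| ≤ k and |κ2| ≤ k such that y d = F x1 d for all d ∉ κ1 and y d = F x2 d for all d ∉ κ2. -/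
/-- Two vectors at Hamming distance at most `2 * k` have a common corruption that alters each of
them on at most `k` coordinates. -/
theorem exists_common_corruption_of_hammingDist_le {ι Y : Type*} [Fintype ι] [DecidableEq ι]
    [DecidableEq Y] {k : ℕ} (u v : ι → Y) (h : hammingDist u v ≤ 2 * k) :
    ∃ (y : ι → Y) (κ1 κ2 : Finset ι), κ1.card ≤ k ∧ κ2.card ≤ k ∧
      (∀ d, d ∉ κ1 → y d = u d) ∧ (∀ d, d ∉ κ2 → y d = v d) := by
  set D : Finset ι := Finset.univ.filter fun d => u d ≠ v d with hD
  have hcard : D.card ≤ 2 * k := h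
  obtain ⟨κ, hκD, hκ⟩ := Finset.exists_subset_card_eq (min_le_right k D.card)
  refine ⟨κ.piecewise v u, κ, D \ κ, by omega, ?_, ?_, ?_⟩
  · rw [Finset.card_sdiff_of_subset hκD]
    omega
  · intro d hd
    simp [hd]
  · intro d hd
    by_cases hdκ : d ∈ κ
    · simp [hdκ]
    · simpa [hD, hdκ] using hd

/-- If `2k ≥ p - θ + 1` and there exist distinct states whose observation vectors
have symbol Hamming distance `p - θ + 1` (i.e., they agree on exactly `θ - 1`
sensors), then exact state recovery against a `k`-adversary is impossible: some
attacked observation vector is consistent with both states. -/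
theorem recovery_impossible_of_large_k {p θ k : ℕ} (hθ : 0 < θ) (hθp : θ ≤ p)
    (hk : 0 < k) (h2k : p - θ + 1 ≤ 2 * k)
    {X Y : Type*} [DecidableEq Y] (F : X → Fin p → Y)
    (x1 x2 : X) (hne : x1 ≠ x2)
    (hdist : hammingDist (F x1) (F x2) = p - θ + 1) :
    ∃ (y : Fin p → Y) (κ1 κ2 : Finset (Fin p)), κ1.card ≤ k ∧ κ2.card ≤ k ∧
      (∀ d, d ∉ κ1 → y d = F x1 d) ∧ (∀ d, d ∉ κ2 → y d = F x2 d) :=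
  exists_common_corruption_of_hammingDist_le (F x1) (F x2) (hdist.trans_le h2k)
end
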